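/- arXiv:1603.06657 — 3 statements merged into one kernel-verified Lean document; each statement's English description precedes it below -/
import Mathlib

section
/- For 0 < q < 1 and any nonzero complex z, the Jacobi theta function θ_q(z) := Σ_{n∈ℤ} q^{n²/2} (−z)^n satisfies Jacobi's triple product identity θ_q(z) = (q; q)_∞ · (q^{1/2} z; q)_∞ · (q^{1/2}/z; q)_∞. -/
open Complex

/-- Jacobi theta function `θ_q(z) = Σ_{n ∈ ℤ} q^(n²/2) (−z)^n`. -/
noncomputable def jacobiTheta' (q : ℝ) (z : ℂ) : ℂ :=
  ∑' n : ℤ, ((q ^ (((n : ℝ) ^ 2) / 2) : ℝ) : ℂ) * (-z) ^ n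

/-- Infinite q-Pochhammer symbol `(a; q)_∞ = ∏_{k ≥ 0} (1 − a q^k)`. -/
noncomputable def qPochInf (a q : ℂ) : ℂ := ∏' k : ℕ, (1 - a * q ^ k)


namespace JTP
open Filter Topology

/-- `(q;q)_n` -/
noncomputable def Q (q : ℂ) (n : ℕ) : ℂ := ∏ i ∈ Finset.range n, (1 - q * q ^ i)

/-- `1/(q;q)_m`, extended by zero to negative integers -/
noncomputable def R (q : ℂ) (m : ℤ) : ℂ := if 0 ≤ m then (Q q m.toNat)⁻¹ else 0

lemma fac_ne {q : ℂ} (hq : ‖q‖ < 1) (n : ℕ) : 1 - q * q ^ n ≠ 0 := by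
  intro h
  have h1 : q ^ (n + 1) = 1 := by rw [pow_succ']; linear_combination -h
  have h2 : ‖q‖ ^ (n + 1) = 1 := by rw [← norm_pow, h1, norm_one]
  have h3 := pow_lt_one₀ (norm_nonneg q) hq (Nat.succ_ne_zero n)
  simp only [Nat.succ_eq_add_one] at h3
  linarith

lemma Q_ne {q : ℂ} (hq : ‖q‖ < 1) (n : ℕ) : Q q n ≠ 0 :=
  Finset.prod_ne_zero_iff.mpr fun i _ => fac_ne hq i

lemma R_nat (q : ℂ) (n : ℕ) : R q n = (Q q n)⁻¹ := by simp [R]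

lemma R_rec {q : ℂ} (hq : ‖q‖ < 1) (m : ℤ) : R q (m - 1) = (1 - q ^ m) * R q m := by
  rcases lt_trichotomy m 0 with h | h | h
  · have h1 : ¬ (0 ≤ m) := by omega
    have h2 : ¬ (0 ≤ m - 1) := by omega
    simp only [R, h1, h2, if_false, mul_zero]
  · subst h; simp [R]
  · obtain ⟨k, rfl⟩ : ∃ k : ℕ, m = ((k + 1 : ℕ) : ℤ) := ⟨(m - 1).toNat, by omega⟩
    have h1 : (((k + 1 : ℕ) : ℤ) - 1) = (k : ℤ) := by push_cast; ring
    rw [h1, R_nat, R_nat, zpow_natCast]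
    have h2 : Q q (k + 1) = Q q k * (1 - q * q ^ k) := by
      simp only [Q, Finset.prod_range_succ]
    rw [h2, pow_succ']
    have := Q_ne hq k
    have := fac_ne hq k
    field_simp

/-- Gaussian binomial `[2n, n+j]`. -/
noncomputable def A (q : ℂ) (n : ℕ) (j : ℤ) : ℂ := Q q (2 * n) * (R q (n + j) * R q (n - j))

lemma A_rec {q : ℂ} (hq : ‖q‖ < 1) (h0 : q ≠ 0) (n : ℕ) (j : ℤ) :
    A q (n + 1) j = (1 + q ^ (2 * n + 1)) * A q n j + q ^ ((n : ℤ) + 1 - j) * A q n (j - 1)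
      + q ^ ((n : ℤ) + 1 + j) * A q n (j + 1) := by
  have hQ : Q q (2 * (n + 1)) = Q q (2 * n) * (1 - q * q ^ (2 * n)) * (1 - q * q ^ (2 * n + 1)) := by
    rw [show 2 * (n + 1) = 2 * n + 1 + 1 by ring]
    simp only [Q, Finset.prod_range_succ]
  have e1 : R q (n + j) = (1 - q ^ ((n : ℤ) + 1 + j)) * R q (n + 1 + j) := by
    rw [← R_rec hq]; congr 1; ring
  have e2 : R q (n - j) = (1 - q ^ ((n : ℤ) + 1 - j)) * R q (n + 1 - j) := by
    rw [← R_rec hq]; congr 1; ring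
  have e3 : R q (n + (j - 1)) = (1 - q ^ ((n : ℤ) + j)) * R q (n + j) := by
    rw [← R_rec hq]; congr 1; ring
  have e4 : R q (n - (j + 1)) = (1 - q ^ ((n : ℤ) - j)) * R q (n - j) := by
    rw [← R_rec hq]; congr 1; ring
  have f1 : q ^ ((n : ℤ) + 1 + j) = q * q ^ ((n : ℤ) + j) := by
    rw [← zpow_one_add₀ h0]; congr 1; ring
  have f2 : q ^ ((n : ℤ) + 1 - j) = q * q ^ ((n : ℤ) - j) := by
    rw [← zpow_one_add₀ h0]; congr 1; ring
  have f3 : q ^ (2 * n) = q ^ ((n : ℤ) + j) * q ^ ((n : ℤ) - j) := by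
    rw [← zpow_add₀ h0, ← zpow_natCast]; congr 1; push_cast; ring
  have g1 : (n : ℤ) - (j - 1) = n + 1 - j := by ring
  have g2 : (n : ℤ) + (j + 1) = n + 1 + j := by ring
  unfold A
  rw [hQ, e3, e4, g1, g2, e1, e2, f1, f2, pow_succ, f3]
  push_cast
  ring

lemma finite_id {q s z : ℂ} (hq : ‖q‖ < 1) (h0 : q ≠ 0) (hz : z ≠ 0) (hs : s ^ 2 = q)
    (u : ℤ → ℂ) (hu0 : u 0 = 1) (hu : ∀ j, u (j + 1) = -(z * s * q ^ j) * u j) (n : ℕ) :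
    HasSum (fun j : ℤ => A q n j * u j)
      (∏ i ∈ Finset.range n, ((1 - s * z * q ^ i) * (1 - s / z * q ^ i))) := by
  induction n with
  | zero =>
    have h := hasSum_single (f := fun j : ℤ => A q 0 j * u j) 0 (by
      intro j hj
      have : R q (0 + j) * R q (0 - j) = 0 := by
        rcases lt_or_gt_of_ne hj with h | h
        · have : ¬ (0 ≤ 0 + j) := by omega
          simp only [R, this, if_false, zero_mul]
        · have : ¬ (0 ≤ 0 - j) := by omega
          simp only [R, this, if_false, mul_zero]
      simp only [A, Nat.cast_zero, this, mul_zero, zero_mul])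
    simpa [A, R, Q, hu0] using h
  | succ n ih =>
    rw [Finset.prod_range_succ]
    have h1 := (Equiv.addRight (-1 : ℤ)).hasSum_iff.mpr ih
    have h2 := (Equiv.addRight (1 : ℤ)).hasSum_iff.mpr ih
    have h := ((ih.mul_left (1 + q ^ (2 * n + 1))).sub (h1.mul_left (s * q ^ n * z))).sub
      (h2.mul_left (s * q ^ n / z))
    convert h using 1
    · rfl
    · funext j
      simp only [Function.comp, Equiv.coe_addRight]
      rw [A_rec hq h0, hu j]
      have hj := hu (j + -1)
      rw [show j + -1 + 1 = j by ring] at hj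
      have hq1 : q ^ ((n : ℤ) + 1 - j) * q ^ (j + -1) = q ^ n := by
        rw [← zpow_add₀ h0, ← zpow_natCast]; congr 1; ring
      have hq2 : q ^ ((n : ℤ) + 1 + j) = s ^ 2 * q ^ n * q ^ j := by
        rw [hs, zpow_add₀ h0, zpow_add₀ h0, zpow_one, zpow_natCast]; ring
      have k1 : q ^ ((n : ℤ) + 1 - j) * u j = - (s * q ^ n * z) * u (j + -1) := by
        rw [hj, ← hq1]; ring
      have k2 : q ^ ((n : ℤ) + 1 + j) * u j = - (s * q ^ n / z) * (-(z * s * q ^ j) * u j) := by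
        rw [hq2]; field_simp
      rw [show j - 1 = j + -1 by ring]
      linear_combination A q n (j + -1) * k1 + A q n (j + 1) * k2
    · have hp : q ^ (2 * n + 1) = s ^ 2 * (q ^ n * q ^ n) := by rw [hs]; ring
      rw [hp]
      field_simp
      ring

lemma summ {q : ℂ} (hq : ‖q‖ < 1) (a : ℂ) : Summable fun k : ℕ => ‖-(a * q ^ k)‖ := by
  simp only [norm_neg, norm_mul, norm_pow]
  exact (summable_geometric_of_lt_one (norm_nonneg q) hq).mul_left _

lemma tend {q : ℂ} (hq : ‖q‖ < 1) (a : ℂ) :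
    Tendsto (fun n => ∏ i ∈ Finset.range n, (1 - a * q ^ i)) atTop (𝓝 (qPochInf a q)) := by
  have h := (multipliable_one_add_of_summable (summ hq a)).hasProd.tendsto_prod_nat
  simpa only [← sub_eq_add_neg, qPochInf] using h

lemma poch_ne {q : ℂ} (hq : ‖q‖ < 1) : qPochInf q q ≠ 0 := by
  have h := tprod_one_add_ne_zero_of_summable (f := fun n : ℕ ↦ -(q * q ^ n))
    (fun i => by simpa only [← sub_eq_add_neg] using fac_ne hq i) (summ hq q)
  simpa only [← sub_eq_add_neg, qPochInf] using h

lemma R_tend {q : ℂ} (hq : ‖q‖ < 1) : Tendsto (R q) atTop (𝓝 (qPochInf q q)⁻¹) := by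
  have h : Tendsto (fun n => (Q q n)⁻¹) atTop (𝓝 (qPochInf q q)⁻¹) :=
    (tend hq q).inv₀ (poch_ne hq)
  have ht : Tendsto Int.toNat atTop atTop :=
    tendsto_atTop.mpr fun b => by
      filter_upwards [eventually_ge_atTop (b : ℤ)] with x hx
      omega
  refine (h.comp ht).congr' ?_
  filter_upwards [eventually_ge_atTop (0 : ℤ)] with x hx
  simp [R, hx]

lemma R_bdd {q : ℂ} (hq : ‖q‖ < 1) : ∃ C, 0 ≤ C ∧ ∀ m, ‖R q m‖ ≤ C := by
  have h : Tendsto (fun n => (Q q n)⁻¹) atTop (𝓝 (qPochInf q q)⁻¹) :=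
    (tend hq q).inv₀ (poch_ne hq)
  obtain ⟨C, hC⟩ := h.norm.bddAbove_range
  have hC' : ∀ n, ‖(Q q n)⁻¹‖ ≤ C := fun n => hC ⟨n, rfl⟩
  have h0 : 0 ≤ C := (norm_nonneg _).trans (hC' 0)
  refine ⟨C, h0, fun m => ?_⟩
  unfold R
  split_ifs
  · exact hC' _
  · simpa using h0

lemma main {q s z : ℂ} (hq : ‖q‖ < 1) (h0 : q ≠ 0) (hz : z ≠ 0) (hs : s ^ 2 = q)
    (u : ℤ → ℂ) (hu0 : u 0 = 1) (hu : ∀ j, u (j + 1) = -(z * s * q ^ j) * u j)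
    (hsum : Summable u) :
    ∑' j, u j = qPochInf q q * qPochInf (s * z) q * qPochInf (s / z) q := by
  obtain ⟨C, hC0, hC⟩ := R_bdd hq
  obtain ⟨D, hD⟩ := (tend hq q).norm.bddAbove_range
  have hD' : ∀ n, ‖Q q n‖ ≤ D := fun n => hD ⟨n, rfl⟩
  have hD0 : 0 ≤ D := (norm_nonneg _).trans (hD' 0)
  have hlim : ∀ j, Tendsto (fun n : ℕ => A q n j * u j) atTop
      (𝓝 ((qPochInf q q)⁻¹ * u j)) := by
    intro j
    have c1 : Tendsto (fun n : ℕ => (n : ℤ) + j) atTop atTop :=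
      tendsto_atTop_add_const_right _ _ tendsto_natCast_atTop_atTop
    have c2 : Tendsto (fun n : ℕ => (n : ℤ) - j) atTop atTop :=
      tendsto_atTop_add_const_right _ _ tendsto_natCast_atTop_atTop
    have c3 : Tendsto (fun n : ℕ => 2 * n) atTop atTop :=
      tendsto_atTop_mono (fun n => by simp only [id]; omega) tendsto_id
    have := (((tend hq q).comp c3).mul (((R_tend hq).comp c1).mul ((R_tend hq).comp c2))).mul_const
      (u j)
    convert this using 2
    · rfl
    · rw [mul_inv_cancel_left₀ (poch_ne hq)]
  have hdom := tendsto_tsum_of_dominated_convergence (𝓕 := atTop)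
    (f := fun (n : ℕ) j => A q n j * u j) (bound := fun j => D * (C * C) * ‖u j‖)
    (hsum.norm.mul_left _) hlim (Eventually.of_forall fun n j => by
      simp only [A, norm_mul]
      gcongr
      · exact hD' _
      · exact hC _
      · exact hC _)
  simp only [(finite_id hq h0 hz hs u hu0 hu _).tsum_eq, Finset.prod_mul_distrib] at hdom
  have huniq := tendsto_nhds_unique hdom ((tend hq (s * z)).mul (tend hq (s / z)))
  rw [tsum_mul_left] at huniq
  rw [mul_assoc, ← huniq, mul_inv_cancel_left₀ (poch_ne hq)]

lemma theta_summable (q : ℝ) (z : ℂ) (hq : 0 < q) (hq1 : q < 1) (hz : z ≠ 0) :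
    Summable fun n : ℤ => ((q ^ (((n : ℝ) ^ 2) / 2) : ℝ) : ℂ) * (-z) ^ n := by
  have hl := Real.log_neg hq hq1
  have hpi := Real.pi_pos
  have hpi' : (Real.pi : ℂ) ≠ 0 := by exact_mod_cast hpi.ne'
  have h := (summable_jacobiTheta₂_term_iff (Complex.log (-z) / (2 * Real.pi * I))
    (((-Real.log q / (2 * Real.pi) : ℝ) : ℂ) * I)).mpr (by
      rw [Complex.im_ofReal_mul, Complex.I_im, mul_one]
      exact div_pos (by linarith) (by positivity))
  refine h.congr fun n => ?_
  rw [jacobiTheta₂_term, Complex.exp_add, Real.rpow_def_of_pos hq, mul_comm]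
  congr 1
  · rw [Complex.ofReal_exp]
    congr 1
    push_cast
    field_simp
    linear_combination (-(Real.log q : ℂ) * n ^ 2) * I_sq
  · conv_rhs => rw [← Complex.exp_log (neg_ne_zero.mpr hz), ← Complex.exp_int_mul]
    congr 1
    field_simp

end JTP

theorem jacobi_triple_product (q : ℝ) (z : ℂ) (hq : 0 < q) (hq1 : q < 1) (hz : z ≠ 0) :
    jacobiTheta' q z =
      qPochInf (q : ℂ) (q : ℂ) * qPochInf ((Real.sqrt q : ℂ) * z) (q : ℂ) *
        qPochInf ((Real.sqrt q : ℂ) / z) (q : ℂ) := by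
  refine JTP.main ?_ ?_ hz ?_ _ ?_ ?_ (JTP.theta_summable q z hq hq1 hz)
  · rw [Complex.norm_real, Real.norm_of_nonneg hq.le]; exact hq1
  · exact_mod_cast hq.ne'
  · exact_mod_cast Real.sq_sqrt hq.le
  · simp
  · intro j
    have h : q ^ ((((j + 1 : ℤ) : ℝ) ^ 2) / 2) = Real.sqrt q * q ^ j * q ^ (((j : ℝ) ^ 2) / 2) := by
      rw [Real.sqrt_eq_rpow, ← Real.rpow_intCast, ← Real.rpow_add hq, ← Real.rpow_add hq]
      congr 1
      push_cast
      ring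
    rw [h, zpow_add_one₀ (neg_ne_zero.mpr hz)]
    push_cast
    ring
end

section
/- For 0 < q < 1 and nonzero complex α, β, γ, w with αβ² = −1 and βγ = q, the identity 1 = (1/2) · (q,q; q²)_∞ / [ ((αq^{1/2}/(γw))q, (αβw/q^{1/2})q; q²)_∞ · ((γw/(αq^{1/2}))q, (q^{1/2}/(αβw))q; q²)_∞ ] · [ (βγw/q^{1/2}, q^{3/2}/(βγw), 1/β, qβ; q)_∞ + (γw/(αβq^{1/2}), αβq^{3/2}/(γw), αβ, q/(αβ); q)_∞ ] holds, provided all denominators are nonzero. -/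
open Complex

open Filter Topology

lemma qp_summable (a q : ℂ) (hq : ‖q‖ < 1) : Summable (fun k : ℕ => ‖-(a * q ^ k)‖) := by
  simp only [norm_neg, norm_mul, norm_pow]
  exact (summable_geometric_of_lt_one (norm_nonneg _) hq).mul_left _

lemma qp_multipliable (a q : ℂ) (hq : ‖q‖ < 1) : Multipliable (fun k : ℕ => 1 - a * q ^ k) := by
  simpa [sub_eq_add_neg] using multipliable_one_add_of_summable (qp_summable a q hq)

lemma qp_tendsto (a q : ℂ) (hq : ‖q‖ < 1) :
    Tendsto (fun N => ∏ k ∈ Finset.range N, (1 - a * q ^ k)) atTop (𝓝 (qPochInf a q)) :=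
  (qp_multipliable a q hq).hasProd.tendsto_prod_nat

lemma qp_ne_zero (a q : ℂ) (hq : ‖q‖ < 1) (h : ∀ k : ℕ, 1 - a * q ^ k ≠ 0) :
    qPochInf a q ≠ 0 := by
  have := tprod_one_add_ne_zero_of_summable (f := fun k : ℕ => -(a * q ^ k))
    (by simpa [sub_eq_add_neg] using h) (qp_summable a q hq)
  simpa [qPochInf, sub_eq_add_neg] using this

/-- finite product `(q;q)_m` -/
noncomputable def pf (q : ℂ) (m : ℕ) : ℂ := ∏ k ∈ Finset.range m, (1 - q * q ^ k)

/-- reciprocal of `(q;q)_m`, zero for negative index -/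
noncomputable def rf (q : ℂ) (m : ℤ) : ℂ := if 0 ≤ m then (pf q m.toNat)⁻¹ else 0

/-- theta term -/
noncomputable def th (s z : ℂ) (n : ℤ) : ℂ := s ^ (n * n - n) * (-z) ^ n

lemma one_sub_ne (q : ℝ) (hq : 0 < q) (hq1 : q < 1) (k : ℕ) : 1 - (q : ℂ) * (q : ℂ) ^ k ≠ 0 := by
  have h : q * q ^ k < 1 := by
    rw [← pow_succ']; exact pow_lt_one₀ hq.le hq1 (by omega)
  have : (1 : ℝ) - q * q ^ k ≠ 0 := by linarith
  exact_mod_cast this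

lemma norm_one_sub_le (q : ℝ) (hq : 0 < q) (hq1 : q < 1) (k : ℕ) :
    ‖1 - (q : ℂ) * (q : ℂ) ^ k‖ ≤ 1 := by
  have h : q * q ^ k < 1 := by
    rw [← pow_succ']; exact pow_lt_one₀ hq.le hq1 (by omega)
  have h0 : 0 < q * q ^ k := by positivity
  have : 1 - (q : ℂ) * (q : ℂ) ^ k = ((1 - q * q ^ k : ℝ) : ℂ) := by push_cast; rfl
  rw [this, Complex.norm_real, Real.norm_eq_abs, abs_le]
  constructor <;> linarith

lemma pf_ne (q : ℝ) (hq : 0 < q) (hq1 : q < 1) (m : ℕ) : pf q m ≠ 0 :=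
  Finset.prod_ne_zero_iff.mpr fun k _ => one_sub_ne q hq hq1 k

lemma pf_norm_le (q : ℝ) (hq : 0 < q) (hq1 : q < 1) (m : ℕ) : ‖pf q m‖ ≤ 1 := by
  rw [pf, norm_prod]
  exact Finset.prod_le_one (fun _ _ => norm_nonneg _) fun k _ => norm_one_sub_le q hq hq1 k

lemma norm_lt (q : ℝ) (hq : 0 < q) (hq1 : q < 1) : ‖(q : ℂ)‖ < 1 := by
  rw [Complex.norm_real, Real.norm_eq_abs, abs_of_pos hq]; exact hq1

lemma qq_ne (q : ℝ) (hq : 0 < q) (hq1 : q < 1) : qPochInf q q ≠ 0 :=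
  qp_ne_zero _ _ (norm_lt q hq hq1) (one_sub_ne q hq hq1)

lemma pf_norm_ge (q : ℝ) (hq : 0 < q) (hq1 : q < 1) (m : ℕ) : ‖qPochInf q q‖ ≤ ‖pf q m‖ := by
  have hanti : Antitone (fun m => ‖pf q m‖) := by
    refine antitone_nat_of_succ_le fun n => ?_
    rw [pf, Finset.prod_range_succ, norm_mul]
    exact mul_le_of_le_one_right (norm_nonneg _) (norm_one_sub_le q hq hq1 n)
  exact hanti.le_of_tendsto (qp_tendsto q q (norm_lt q hq hq1)).norm m

lemma rf_norm_le (q : ℝ) (hq : 0 < q) (hq1 : q < 1) (m : ℤ) :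
    ‖rf q m‖ ≤ ‖qPochInf q q‖⁻¹ := by
  unfold rf
  split_ifs
  · rw [norm_inv]
    exact inv_anti₀ (norm_pos_iff.mpr (qq_ne q hq hq1)) (pf_norm_ge q hq hq1 _)
  · simp

lemma rf_rec (q : ℝ) (hq : 0 < q) (hq1 : q < 1) (m : ℤ) :
    rf q (m - 1) = (1 - (q : ℂ) ^ m) * rf q m := by
  unfold rf
  rcases lt_trichotomy m 0 with h | h | h
  · rw [if_neg (by omega), if_neg (by omega)]; simp
  · subst h; simp
  · obtain ⟨k, rfl⟩ : ∃ k : ℕ, m = k + 1 := ⟨(m - 1).toNat, by omega⟩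
    rw [if_pos (by omega), if_pos (by omega)]
    have e1 : ((k : ℤ) + 1 - 1).toNat = k := by omega
    have e2 : ((k : ℤ) + 1).toNat = k + 1 := by omega
    rw [e1, e2]
    have h1 := pf_ne q hq hq1 k
    have h2 := one_sub_ne q hq hq1 k
    have e3 : pf q (k + 1) = pf q k * (1 - (q : ℂ) * (q : ℂ) ^ k) := by
      rw [pf, Finset.prod_range_succ]; rfl
    have e4 : (q : ℂ) ^ ((k : ℤ) + 1) = (q : ℂ) * (q : ℂ) ^ k := by
      rw [← pow_succ']; exact_mod_cast zpow_natCast (q : ℂ) (k + 1)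
    rw [e3, e4, mul_inv]
    field_simp

lemma rf_tendsto (q : ℝ) (hq : 0 < q) (hq1 : q < 1) (c : ℕ → ℤ) (hc : Tendsto c atTop atTop) :
    Tendsto (fun N => rf q (c N)) atTop (𝓝 (qPochInf q q)⁻¹) := by
  have h1 : Tendsto (fun N => (c N).toNat) atTop atTop :=
    tendsto_atTop.2 fun b => (hc.eventually_ge_atTop (b : ℤ)).mono fun N h => by omega
  have h2 := ((qp_tendsto q q (norm_lt q hq hq1)).comp h1).inv₀ (qq_ne q hq hq1)
  refine h2.congr' ?_
  filter_upwards [hc.eventually_ge_atTop 0] with N hN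
  simp [rf, hN, pf]

lemma finite_jtp (s : ℝ) (hs : 0 < s) (hs1 : s < 1) (q : ℝ) (hqs : q = s ^ 2) (z : ℂ) (hz : z ≠ 0)
    (N : ℕ) :
    HasSum (fun n : ℤ => pf q (2 * N) * rf q (N + n) * rf q (N - n) * th s z n)
      ((∏ k ∈ Finset.range N, (1 - z * (q : ℂ) ^ k)) *
        ∏ k ∈ Finset.range N, (1 - q / z * (q : ℂ) ^ k)) := by
  have hq : 0 < q := by rw [hqs]; positivity
  have hq1 : q < 1 := by rw [hqs]; exact pow_lt_one₀ hs.le hs1 (by norm_num)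
  have hqc : (q : ℂ) = (s : ℂ) ^ 2 := by rw [hqs]; push_cast; rfl
  have hs0 : (s : ℂ) ≠ 0 := by exact_mod_cast hs.ne'
  have hq0 : (q : ℂ) ≠ 0 := by exact_mod_cast hq.ne'
  have hz' : -z ≠ 0 := neg_ne_zero.mpr hz
  induction N with
  | zero =>
    have := hasSum_single (f := fun n : ℤ => pf q (2 * 0) * rf q ((0 : ℕ) + n) *
      rf q ((0 : ℕ) - n) * th s z n) 0 (by
        intro n hn
        rcases lt_or_gt_of_ne hn with h | h
        · have : rf q (((0 : ℕ) : ℤ) + n) = 0 := by rw [rf, if_neg (by push_cast; omega)]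
          simp only [this]; ring
        · have : rf q (((0 : ℕ) : ℤ) - n) = 0 := by rw [rf, if_neg (by push_cast; omega)]
          simp only [this]; ring)
    simpa [rf, pf, th] using this
  | succ N ih =>
    have hm := ((Equiv.addRight (-1 : ℤ)).hasSum_iff).mpr ih
    have hp := ((Equiv.addRight (1 : ℤ)).hasSum_iff).mpr ih
    have key := ((ih.mul_left (1 + (q : ℂ) ^ (2 * N + 1))).add
      (hm.mul_left (-z * (q : ℂ) ^ N))).add (hp.mul_left (-(1 / z) * (q : ℂ) ^ (N + 1)))
    have hv : ∀ A B : ℂ, (A * (1 - z * (q : ℂ) ^ N)) * (B * (1 - q / z * (q : ℂ) ^ N)) =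
        (1 + (q : ℂ) ^ (2 * N + 1)) * (A * B) + -z * (q : ℂ) ^ N * (A * B) +
          -(1 / z) * (q : ℂ) ^ (N + 1) * (A * B) := by
      intro A B
      field_simp
      ring
    rw [Finset.prod_range_succ, Finset.prod_range_succ, hv]
    refine key.congr_fun fun n => ?_
    · simp only [Function.comp, Equiv.coe_addRight]
      have t1 : -z * th s z (n + -1) = th s z n * ((q : ℂ) * ((q : ℂ) ^ n)⁻¹) := by
        unfold th
        rw [hqc, show (n + -1) * (n + -1) - (n + -1) = (n * n - n) + (2 - 2 * n) by ring,
          zpow_add₀ hs0, zpow_add₀ hz', zpow_sub₀ hs0 2 (2 * n), zpow_mul (s : ℂ) 2 n, zpow_neg_one, zpow_ofNat]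
        have hb2 : ((s : ℂ) ^ 2) ^ n ≠ 0 := zpow_ne_zero _ (pow_ne_zero 2 hs0)
        generalize ((s : ℂ) ^ 2) ^ n = b2 at *
        field_simp
      have t2 : -(1 / z) * th s z (n + 1) = th s z n * (q : ℂ) ^ n := by
        unfold th
        rw [hqc, show (n + 1) * (n + 1) - (n + 1) = (n * n - n) + 2 * n by ring,
          zpow_add₀ hs0, zpow_add₀ hz', zpow_mul, zpow_one, zpow_ofNat]
        field_simp
      have p1 : pf q (2 * (N + 1)) = pf q (2 * N) * (1 - q * (q : ℂ) ^ (2 * N)) *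
          (1 - q * (q : ℂ) ^ (2 * N + 1)) := by
        rw [show 2 * (N + 1) = 2 * N + 1 + 1 by ring, pf, Finset.prod_range_succ,
          Finset.prod_range_succ]; rfl
      have r1 := rf_rec q hq hq1 (N + n + 1)
      have r2 := rf_rec q hq hq1 (N - n + 1)
      have r3 := rf_rec q hq hq1 (N + n)
      have r4 := rf_rec q hq hq1 (N - n)
      rw [add_sub_cancel_right] at r1 r2
      have c1 : ((N + 1 : ℕ) : ℤ) + n = N + n + 1 := by push_cast; ring
      have c2 : ((N + 1 : ℕ) : ℤ) - n = N - n + 1 := by push_cast; ring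
      have c3 : (N : ℤ) + (n + -1) = N + n - 1 := by ring
      have c4 : (N : ℤ) - (n + -1) = N - n + 1 := by ring
      have c5 : (N : ℤ) + (n + 1) = N + n + 1 := by ring
      have c6 : (N : ℤ) - (n + 1) = N - n - 1 := by ring
      rw [c1, c2, c3, c4, c5, c6, r3, r4, r1, r2, p1]
      have e1 : (q : ℂ) ^ ((N : ℤ) + n) = (q : ℂ) ^ N * (q : ℂ) ^ n := by
        rw [zpow_add₀ hq0, zpow_natCast]
      have e2 : (q : ℂ) ^ ((N : ℤ) - n) = (q : ℂ) ^ N * ((q : ℂ) ^ n)⁻¹ := by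
        rw [zpow_sub₀ hq0, zpow_natCast]; rfl
      have e3 : (q : ℂ) ^ ((N : ℤ) + n + 1) = (q : ℂ) ^ N * (q : ℂ) ^ n * q := by
        rw [zpow_add₀ hq0, e1, zpow_one]
      have e4 : (q : ℂ) ^ ((N : ℤ) - n + 1) = (q : ℂ) ^ N * ((q : ℂ) ^ n)⁻¹ * q := by
        rw [zpow_add₀ hq0, e2, zpow_one]
      rw [e1, e2, e3, e4, pow_succ, pow_succ, mul_comm 2 N, pow_mul]
      have hb : (q : ℂ) ^ n ≠ 0 := zpow_ne_zero _ hq0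
      generalize (q : ℂ) ^ n = b at *
      generalize (q : ℂ) ^ N = a at *
      generalize rf q (N + n + 1) = u at *
      generalize rf q (N - n + 1) = v at *
      generalize pf q (N * 2) = p at *
      generalize th s z (n + -1) = tm at *
      generalize th s z (n + 1) = tp at *
      generalize th s z n = t at *
      generalize (q : ℂ) = x at *
      have f : ∀ A B C : ℂ, A + -z * a * (B * tm) + -(1 / z) * (a * x) * (C * tp)
          = A + a * B * (-z * tm) + a * x * C * (-(1 / z) * tp) := by intros; ring
      rw [f, t1, t2]
      field_simp
      ring

lemma th_summable (s : ℝ) (hs : 0 < s) (hs1 : s < 1) (z : ℂ) (hz : z ≠ 0) :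
    Summable (fun n : ℤ => ‖th s z n‖) := by
  have hs0 : (s : ℂ) ≠ 0 := by exact_mod_cast hs.ne'
  have hz' : -z ≠ 0 := neg_ne_zero.mpr hz
  have hne : ∀ n, th s z n ≠ 0 := fun n => mul_ne_zero (zpow_ne_zero _ hs0) (zpow_ne_zero _ hz')
  have hlim : Tendsto (fun n : ℕ => (s ^ 2) ^ n) atTop (𝓝 0) :=
    tendsto_pow_atTop_nhds_zero_of_lt_one (by positivity) (pow_lt_one₀ hs.le hs1 (by norm_num))
  have hns : ‖(s : ℂ)‖ = s := by rw [Complex.norm_real, Real.norm_eq_abs, abs_of_pos hs]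
  apply Summable.of_nat_of_neg
  · refine summable_of_ratio_test_tendsto_lt_one (l := 0) one_pos
      (Eventually.of_forall fun n => norm_ne_zero_iff.mpr (hne _)) ?_
    have := hlim.mul_const ‖z‖
    rw [zero_mul] at this
    refine this.congr fun n => ?_
    simp only [norm_norm]
    rw [← norm_div]
    have : th s z ((n + 1 : ℕ) : ℤ) / th s z n = ((s : ℂ) ^ 2) ^ n * (-z) := by
      rw [div_eq_iff (hne _)]
      unfold th
      push_cast
      rw [show ((n : ℤ) + 1) * (n + 1) - (n + 1) = (n * n - n) + 2 * n by ring,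
          zpow_add₀ hs0, zpow_add₀ hz', zpow_mul, zpow_one, zpow_ofNat, zpow_natCast ((s : ℂ) ^ 2)]
      ring
    rw [this, norm_mul, norm_neg, norm_pow, norm_pow, hns]
  · refine summable_of_ratio_test_tendsto_lt_one (l := 0) one_pos
      (Eventually.of_forall fun n => norm_ne_zero_iff.mpr (hne _)) ?_
    have := hlim.mul_const (s ^ 2 * ‖z‖⁻¹)
    rw [zero_mul] at this
    refine this.congr fun n => ?_
    simp only [norm_norm]
    rw [← norm_div]
    have : th s z (-((n + 1 : ℕ) : ℤ)) / th s z (-n) = ((s : ℂ) ^ 2) ^ n * ((s : ℂ) ^ 2 * (-z)⁻¹) := by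
      rw [div_eq_iff (hne _)]
      unfold th
      push_cast
      rw [show (-((n : ℤ) + 1)) * (-(n + 1)) - (-(n + 1)) = (-n * -n - -n) + (2 * n + 2) by ring,
          show -((n : ℤ) + 1) = -n + -1 by ring,
          zpow_add₀ hs0, zpow_add₀ hs0, zpow_add₀ hz', zpow_mul (s : ℂ) 2 n, zpow_neg_one,
          zpow_ofNat, zpow_natCast ((s : ℂ) ^ 2)]
      ring
    rw [this, norm_mul, norm_mul, norm_inv, norm_neg, norm_pow, norm_pow, hns]

lemma jtp (s : ℝ) (hs : 0 < s) (hs1 : s < 1) (q : ℝ) (hqs : q = s ^ 2) (z : ℂ) (hz : z ≠ 0) :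
    HasSum (th s z) (qPochInf q q * (qPochInf z q * qPochInf (q / z) q)) := by
  have hq : 0 < q := by rw [hqs]; positivity
  have hq1 : q < 1 := by rw [hqs]; exact pow_lt_one₀ hs.le hs1 (by norm_num)
  have hqn := norm_lt q hq hq1
  have hQ := qq_ne q hq hq1
  have hsum := th_summable s hs hs1 z hz
  have h1 := tendsto_tsum_of_dominated_convergence (𝓕 := atTop)
    (f := fun (N : ℕ) (n : ℤ) => pf q (2 * N) * rf q (N + n) * rf q (N - n) * th s z n)
    (g := fun n => qPochInf q q * (qPochInf q q)⁻¹ * (qPochInf q q)⁻¹ * th s z n)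
    (bound := fun n => 1 * ‖qPochInf q q‖⁻¹ * ‖qPochInf q q‖⁻¹ * ‖th s z n‖)
    (hsum.mul_left _)
    (by
      intro n
      refine Tendsto.mul_const _ (((Tendsto.mul ?_ ?_)).mul ?_)
      · exact (qp_tendsto q q hqn).comp (tendsto_id.const_mul_atTop' (by norm_num))
      · exact rf_tendsto q hq hq1 _ (tendsto_atTop_add_const_right _ n tendsto_natCast_atTop_atTop)
      · exact rf_tendsto q hq hq1 _
          (tendsto_atTop_add_const_right _ (-n) tendsto_natCast_atTop_atTop))
    (Eventually.of_forall fun N n => by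
      rw [norm_mul, norm_mul, norm_mul]
      gcongr
      · exact pf_norm_le q hq hq1 _
      · exact rf_norm_le q hq hq1 _
      · exact rf_norm_le q hq hq1 _)
  have h2 := (qp_tendsto z q hqn).mul (qp_tendsto (q / z) q hqn)
  have h3 := tendsto_nhds_unique
    (h1.congr fun N => (finite_jtp s hs hs1 q hqs z hz N).tsum_eq) h2
  rw [tsum_mul_left, mul_inv_cancel₀ hQ, one_mul] at h3
  rw [← h3, mul_inv_cancel_left₀ hQ]
  exact hsum.of_norm.hasSum

lemma qp_split (q : ℝ) (hq : 0 < q) (hq1 : q < 1) :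
    qPochInf q q = qPochInf q ((q : ℂ) ^ 2) * qPochInf ((q : ℂ) ^ 2) ((q : ℂ) ^ 2) := by
  have hqn := norm_lt q hq hq1
  have hqn2 : ‖(q : ℂ) ^ 2‖ < 1 := by
    rw [norm_pow]; exact pow_lt_one₀ (norm_nonneg _) hqn (by norm_num)
  have := tprod_even_mul_odd (f := fun k : ℕ => 1 - (q : ℂ) * (q : ℂ) ^ k)
    (by simpa only [pow_mul] using qp_multipliable q ((q : ℂ) ^ 2) hqn2)
    (by
      refine (qp_multipliable ((q : ℂ) ^ 2) ((q : ℂ) ^ 2) hqn2).congr fun k => ?_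
      ring)
  unfold qPochInf
  rw [← this]
  congr 1
  · refine tprod_congr fun k => ?_
    ring
  · refine tprod_congr fun k => ?_
    ring

lemma theta_identity (q : ℝ) (hq : 0 < q) (hq1 : q < 1) (z b : ℂ) (hz : z ≠ 0) (hb : b ≠ 0) :
    2 * ((qPochInf (-(z * b)) ((q : ℂ) ^ 2) * qPochInf ((q : ℂ) ^ 2 / (-(z * b))) ((q : ℂ) ^ 2)) *
      (qPochInf (-(q * z / b)) ((q : ℂ) ^ 2) *
        qPochInf ((q : ℂ) ^ 2 / (-(q * z / b))) ((q : ℂ) ^ 2))) =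
    qPochInf q ((q : ℂ) ^ 2) ^ 2 *
      ((qPochInf z q * qPochInf (q / z) q) * (qPochInf b q * qPochInf (q / b) q) +
       (qPochInf (-z) q * qPochInf (q / (-z)) q) * (qPochInf (-b) q * qPochInf (q / (-b)) q)) := by
  have hq0 : (q : ℂ) ≠ 0 := by exact_mod_cast hq.ne'
  obtain ⟨s, hs, hs1, hqs⟩ : ∃ s : ℝ, 0 < s ∧ s < 1 ∧ q = s ^ 2 :=
    ⟨Real.sqrt q, Real.sqrt_pos.mpr hq, by
      rw [Real.sqrt_lt' one_pos]; simpa using hq1, (Real.sq_sqrt hq.le).symm⟩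
  have hs0 : (s : ℂ) ≠ 0 := by exact_mod_cast hs.ne'
  have prod : ∀ (s : ℝ) (hs : 0 < s) (hs1 : s < 1) (q : ℝ) (hqs : q = s ^ 2) (x y : ℂ)
      (hx : x ≠ 0) (hy : y ≠ 0), HasSum (fun p : ℤ × ℤ => th s x p.1 * th s y p.2)
      ((qPochInf q q * (qPochInf x q * qPochInf (q / x) q)) *
       (qPochInf q q * (qPochInf y q * qPochInf (q / y) q))) := by
    intro s hs hs1 q hqs x y hx hy
    exact (jtp s hs hs1 q hqs x hx).mul (jtp s hs hs1 q hqs y hy)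
      (summable_mul_of_summable_norm (th_summable s hs hs1 x hx) (th_summable s hs hs1 y hy))
  have A := (prod s hs hs1 q hqs z b hz hb).add
    (prod s hs hs1 q hqs (-z) (-b) (neg_ne_zero.mpr hz) (neg_ne_zero.mpr hb))
  have hzb : -(z * b) ≠ 0 := neg_ne_zero.mpr (mul_ne_zero hz hb)
  have hzb' : -(q * z / b) ≠ 0 := neg_ne_zero.mpr (div_ne_zero (mul_ne_zero hq0 hz) hb)
  have B := (prod q hq hq1 (q ^ 2) rfl _ _ hzb hzb').mul_left 2
  let g : ℤ × ℤ → ℤ × ℤ := fun p => (p.1 + p.2, p.1 - p.2)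
  have hg : Function.Injective g := by
    rintro ⟨a, b⟩ ⟨c, d⟩ h
    simp only [g, Prod.mk.injEq] at h ⊢
    omega
  have A' := (hg.hasSum_iff (by
    rintro ⟨n, m⟩ hx
    have hodd : Odd (n + m) := by
      by_contra hne
      rw [Int.not_odd_iff_even] at hne
      obtain ⟨k, hk⟩ := hne
      exact hx ⟨(k, n - k), by simp only [g, Prod.mk.injEq]; omega⟩
    have hneg : (-1 : ℂ) ^ n * (-1 : ℂ) ^ m = -1 := by
      rw [← zpow_add₀ (by norm_num)]; exact hodd.neg_one_zpow
    simp only [th, neg_neg]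
    rw [show (-z) = (-1) * z by ring, show (-b) = (-1) * b by ring, mul_zpow, mul_zpow]
    linear_combination ((s : ℂ) ^ (n * n - n) * z ^ n * (s : ℂ) ^ (m * m - m) * b ^ m) * hneg)).mpr A
  have e := A'.unique (B.congr_fun ?_)
  · have hsp := qp_split q hq hq1
    have hQ := qq_ne q hq hq1
    push_cast at e
    have h2 : qPochInf ((q : ℂ) ^ 2) ((q : ℂ) ^ 2) ≠ 0 := by
      intro h; rw [h, mul_zero] at hsp; exact hQ hsp
    rw [hsp] at e
    have h4 := pow_ne_zero 2 h2
    apply mul_left_cancel₀ h4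
    linear_combination -e
  · rintro ⟨k, l⟩
    have hqc : (q : ℂ) = (s : ℂ) ^ (2 : ℤ) := by rw [hqs]; push_cast; norm_cast
    have hneg : (-1 : ℂ) ^ (k + l) * (-1 : ℂ) ^ (k - l) = 1 := by
      rw [← zpow_add₀ (by norm_num)]
      exact Even.neg_one_zpow ⟨k, by ring⟩
    have hsx : (s : ℂ) ^ ((k + l) * (k + l) - (k + l)) * (s : ℂ) ^ ((k - l) * (k - l) - (k - l)) =
        (q : ℂ) ^ (k * k - k) * (q : ℂ) ^ (l * l - l) * (q : ℂ) ^ l := by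
      rw [hqc, ← zpow_mul, ← zpow_mul, ← zpow_mul, ← zpow_add₀ hs0, ← zpow_add₀ hs0,
        ← zpow_add₀ hs0]
      congr 1
      ring
    have hzx : z ^ (k + l) * b ^ (k - l) = (z * b) ^ k * (z ^ l / b ^ l) := by
      rw [zpow_add₀ hz, zpow_sub₀ hb, mul_zpow]
      ring
    have hw : ((q : ℂ) * z / b) ^ l = (q : ℂ) ^ l * (z ^ l / b ^ l) := by
      rw [div_zpow, mul_zpow, mul_div_assoc]
    simp only [g, th, Function.comp, neg_neg]
    rw [show (-z) = (-1) * z by ring, show (-b) = (-1) * b by ring, mul_zpow (-1), mul_zpow (-1), hw]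
    generalize (s : ℂ) ^ ((k + l) * (k + l) - (k + l)) = s1 at *
    generalize (s : ℂ) ^ ((k - l) * (k - l) - (k - l)) = s2 at *
    linear_combination (s1 * s2 * z ^ (k + l) * b ^ (k - l)) * hneg + 2 * s1 * s2 * hzx
      + 2 * (z * b) ^ k * (z ^ l / b ^ l) * hsx

theorem product_identity_one (q : ℝ) (α β γ w : ℂ)
    (hq : 0 < q) (hq1 : q < 1)
    (hα : α ≠ 0) (hβ : β ≠ 0) (hγ : γ ≠ 0) (hw : w ≠ 0)
    (hc1 : α * β ^ 2 = -1) (hc2 : β * γ = (q : ℂ))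
    (hd : qPochInf (α * (Real.sqrt q : ℂ) / (γ * w) * (q : ℂ)) ((q : ℂ) ^ 2) *
          qPochInf (α * β * w / (Real.sqrt q : ℂ) * (q : ℂ)) ((q : ℂ) ^ 2) *
          (qPochInf (γ * w / (α * (Real.sqrt q : ℂ)) * (q : ℂ)) ((q : ℂ) ^ 2) *
            qPochInf ((Real.sqrt q : ℂ) / (α * β * w) * (q : ℂ)) ((q : ℂ) ^ 2)) ≠ 0) :
    (1 : ℂ) =
      (1 / 2) *
        (qPochInf (q : ℂ) ((q : ℂ) ^ 2) * qPochInf (q : ℂ) ((q : ℂ) ^ 2)) /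
        (qPochInf (α * (Real.sqrt q : ℂ) / (γ * w) * (q : ℂ)) ((q : ℂ) ^ 2) *
          qPochInf (α * β * w / (Real.sqrt q : ℂ) * (q : ℂ)) ((q : ℂ) ^ 2) *
          (qPochInf (γ * w / (α * (Real.sqrt q : ℂ)) * (q : ℂ)) ((q : ℂ) ^ 2) *
            qPochInf ((Real.sqrt q : ℂ) / (α * β * w) * (q : ℂ)) ((q : ℂ) ^ 2))) *
        (qPochInf (β * γ * w / (Real.sqrt q : ℂ)) (q : ℂ) *
            qPochInf ((q : ℂ) * (Real.sqrt q : ℂ) / (β * γ * w)) (q : ℂ) *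
            qPochInf (1 / β) (q : ℂ) * qPochInf ((q : ℂ) * β) (q : ℂ)
          +
          qPochInf (γ * w / (α * β * (Real.sqrt q : ℂ))) (q : ℂ) *
            qPochInf (α * β * (q : ℂ) * (Real.sqrt q : ℂ) / (γ * w)) (q : ℂ) *
            qPochInf (α * β) (q : ℂ) * qPochInf ((q : ℂ) / (α * β)) (q : ℂ)) := by
  rw [one_div_mul_eq_div, div_div, div_mul_eq_mul_div, eq_div_iff (mul_ne_zero two_ne_zero hd), one_mul]
  have hs0 : (Real.sqrt q : ℂ) ≠ 0 := by exact_mod_cast (Real.sqrt_pos.mpr hq).ne'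
  have hss : (q : ℂ) = (Real.sqrt q : ℂ) ^ 2 := by
    exact_mod_cast (Real.sq_sqrt hq.le).symm
  have hα' : α = -1 / β ^ 2 := by
    rw [eq_div_iff (pow_ne_zero 2 hβ)]; exact hc1
  have hγ' : γ = (q : ℂ) / β := by
    rw [eq_div_iff hβ]; rw [mul_comm]; exact hc2
  have key := theta_identity q hq hq1 ((Real.sqrt q : ℂ) * w) (1 / β) (mul_ne_zero hs0 hw)
    (one_div_ne_zero hβ)
  clear hd hc1 hc2
  subst hα' hγ'
  generalize (Real.sqrt q : ℂ) = s at *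
  generalize (q : ℂ) = x at *
  subst hss
  have a1 : -1 / β ^ 2 * s / (s ^ 2 / β * w) * s ^ 2 = (s ^ 2) ^ 2 / (-(s ^ 2 * (s * w) / (1 / β))) := by
    field_simp
  have a2 : -1 / β ^ 2 * β * w / s * s ^ 2 = -(s * w * (1 / β)) := by field_simp
  have a3 : s ^ 2 / β * w / (-1 / β ^ 2 * s) * s ^ 2 = -(s ^ 2 * (s * w) / (1 / β)) := by field_simp
  have a4 : s / (-1 / β ^ 2 * β * w) * s ^ 2 = (s ^ 2) ^ 2 / (-(s * w * (1 / β))) := by field_simp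
  have a5 : β * (s ^ 2 / β) * w / s = s * w := by field_simp
  have a6 : s ^ 2 * s / (β * (s ^ 2 / β) * w) = s ^ 2 / (s * w) := by field_simp
  have a7 : s ^ 2 * β = s ^ 2 / (1 / β) := by field_simp
  have a8 : s ^ 2 / β * w / (-1 / β ^ 2 * β * s) = -(s * w) := by field_simp
  have a9 : -1 / β ^ 2 * β * s ^ 2 * s / (s ^ 2 / β * w) = s ^ 2 / (-(s * w)) := by field_simp
  have a10 : -1 / β ^ 2 * β = -(1 / β) := by field_simp
  rw [a1, a2, a3, a4, a5, a6, a7, a8, a9, a10]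
  linear_combination key
end

section
/- The q-gamma function Γ_q(z) := ((q; q)_∞/(q^z; q)_∞)(1 − q)^{1−z} converges to the gamma function Γ(z) as q → 1⁻, for z not a nonpositive integer. -/
open Complex Filter

/-- The q-gamma function `Γ_q(z) = ((q; q)_∞ / (q^z; q)_∞) (1 − q)^{1 − z}`. -/
noncomputable def qGamma (q : ℝ) (z : ℂ) : ℂ :=
  qPochInf (q : ℂ) (q : ℂ) / qPochInf ((q : ℂ) ^ z) (q : ℂ) * ((1 : ℂ) - q) ^ (1 - z)

/-- `log (1 - e^{-tw})`. -/
noncomputable def qgL (t : ℝ) (w : ℂ) : ℂ := Complex.log (1 - Complex.exp (-(t * w)))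

/-- Second-difference-like remainder. -/
noncomputable def qgR (g : ℂ → ℂ) (z : ℂ) (n : ℕ) : ℂ :=
  g (n + z) - g (n + 1) - (z - 1) * (g (n + 2) - g (n + 1))

lemma qg_norm_lt {t : ℝ} (ht : 0 < t) {w : ℂ} (hw : 0 < w.re) :
    ‖Complex.exp (-(t * w))‖ < 1 := by
  rw [Complex.norm_exp, Real.exp_lt_one_iff]
  simp
  positivity

lemma qg_slit {t : ℝ} (ht : 0 < t) {w : ℂ} (hw : 0 < w.re) :
    1 - Complex.exp (-(t * w)) ∈ Complex.slitPlane := by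
  left
  have h1 := (Complex.abs_re_le_norm _).trans_lt (qg_norm_lt ht hw)
  rw [Complex.sub_re, Complex.one_re]
  linarith [(abs_lt.1 h1).2]

lemma qg_ne {t : ℝ} (ht : 0 < t) {w : ℂ} (hw : 0 < w.re) :
    Complex.exp (t * w) - 1 ≠ 0 := by
  intro h
  have h1 := Complex.slitPlane_ne_zero (qg_slit ht hw)
  rw [Complex.exp_neg, sub_eq_zero.1 h] at h1
  simp at h1

lemma qg_deriv1 {t : ℝ} (ht : 0 < t) {w : ℂ} (hw : 0 < w.re) :
    HasDerivAt (qgL t) (t / (Complex.exp (t * w) - 1)) w := by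
  have h0 : HasDerivAt (fun w : ℂ => 1 - Complex.exp (-(t * w)))
      (-(Complex.exp (-(t * w)) * (-(t * 1)))) w :=
    (((hasDerivAt_id w).const_mul (t : ℂ)).neg.cexp).const_sub 1
  have h1 : HasDerivAt (qgL t) _ w := h0.clog (qg_slit ht hw)
  refine h1.congr_deriv ?_
  symm
  have h2 := Complex.slitPlane_ne_zero (qg_slit ht hw)
  have h3 := qg_ne ht hw
  rw [Complex.exp_neg] at h2 ⊢
  have h4 := Complex.exp_ne_zero (t * w)
  have h5 : 1 - (Complex.exp (t * w))⁻¹ = (Complex.exp (t * w) - 1) / Complex.exp (t * w) := by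
    field_simp
  rw [h5]
  field_simp

lemma qg_deriv2 {t : ℝ} (ht : 0 < t) {w : ℂ} (hw : 0 < w.re) :
    HasDerivAt (fun w : ℂ => (t : ℂ) / (Complex.exp (t * w) - 1))
      (-(t ^ 2 * Complex.exp (t * w)) / (Complex.exp (t * w) - 1) ^ 2) w := by
  have h0 : HasDerivAt (fun w : ℂ => Complex.exp (t * w) - 1)
      (Complex.exp (t * w) * (t * 1)) w :=
    (((hasDerivAt_id w).const_mul (t : ℂ)).cexp).sub_const 1
  have h1 := (hasDerivAt_const w (t : ℂ)).div h0 (qg_ne ht hw)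
  refine h1.congr_deriv ?_
  ring

lemma qg_real {y : ℝ} (hy : 0 ≤ y) : y ^ 2 * Real.exp y ≤ (Real.exp y - 1) ^ 2 := by
  have h1 : y / 2 ≤ Real.sinh (y / 2) := Real.self_le_sinh_iff.2 (by positivity)
  rw [Real.sinh_eq] at h1
  have h2 : Real.exp y = Real.exp (y / 2) ^ 2 := by
    rw [← Real.exp_nat_mul]; congr 1; push_cast; ring
  have h3 : Real.exp (y / 2) * Real.exp (-(y / 2)) = 1 := by
    rw [← Real.exp_add]; simp
  have h4 := Real.exp_pos (y / 2)
  have h5 : y * Real.exp (y / 2) ≤ Real.exp y - 1 := by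
    rw [h2]; nlinarith
  calc y ^ 2 * Real.exp y = (y * Real.exp (y / 2)) ^ 2 := by rw [h2]; ring
    _ ≤ _ := by gcongr

lemma qg_bound2 {t : ℝ} (ht : 0 < t) {a : ℝ} (ha : 0 < a) {w : ℂ} (hw : a ≤ w.re) :
    ‖-(t ^ 2 * Complex.exp (t * w)) / (Complex.exp (t * w) - 1) ^ 2‖ ≤ 1 / a ^ 2 := by
  have hw0 : 0 < w.re := ha.trans_le hw
  have hn : ‖Complex.exp (t * w)‖ = Real.exp (t * w.re) := by
    rw [Complex.norm_exp]; simp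
  have h1 : Real.exp (t * w.re) - 1 ≤ ‖Complex.exp (t * w) - 1‖ := by
    have := norm_sub_norm_le (Complex.exp (t * w)) 1
    rwa [hn, norm_one] at this
  have h0 : 0 < Real.exp (t * w.re) - 1 := by
    have := Real.one_lt_exp_iff.2 (mul_pos ht hw0); linarith
  have h2 := qg_real (mul_pos ht hw0).le
  rw [norm_div, norm_neg, norm_mul, norm_pow, norm_pow, hn, Complex.norm_real,
    Real.norm_of_nonneg ht.le, div_le_div_iff₀ (by have := h0.trans_le h1; positivity)
      (by positivity), one_mul]
  calc t ^ 2 * Real.exp (t * w.re) * a ^ 2 ≤ t ^ 2 * Real.exp (t * w.re) * w.re ^ 2 := by gcongr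
    _ = (t * w.re) ^ 2 * Real.exp (t * w.re) := by ring
    _ ≤ _ := h2
    _ ≤ _ := by gcongr

lemma qg_taylor {t : ℝ} (ht : 0 < t) {a : ℝ} (ha : 0 < a) {u v : ℂ} (hu : a ≤ u.re)
    (hv : a ≤ v.re) :
    ‖qgL t v - qgL t u - (v - u) * (t / (Complex.exp (t * u) - 1))‖
      ≤ ‖v - u‖ ^ 2 / a ^ 2 := by
  have hc : Convex ℝ {w : ℂ | a ≤ w.re} := convex_halfSpace_re_ge a
  have hsub : segment ℝ u v ⊆ {w : ℂ | a ≤ w.re} := hc.segment_subset hu hv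
  have hlip : ∀ w ∈ segment ℝ u v,
      ‖(t : ℂ) / (Complex.exp (t * w) - 1) - t / (Complex.exp (t * u) - 1)‖
        ≤ 1 / a ^ 2 * ‖v - u‖ := by
    intro w hw
    have h1 := Convex.norm_image_sub_le_of_norm_hasDerivWithin_le
      (f := fun w : ℂ => (t : ℂ) / (Complex.exp (t * w) - 1))
      (fun x hx => (qg_deriv2 ht (ha.trans_le hx)).hasDerivWithinAt)
      (fun x hx => qg_bound2 ht ha hx) hc hu (hsub hw)
    refine h1.trans ?_
    gcongr
    have := norm_sub_le_of_mem_segment hw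
    simpa using this
  have h2 := Convex.norm_image_sub_le_of_norm_hasDerivWithin_le
      (f := fun w : ℂ => qgL t w - w * (t / (Complex.exp (t * u) - 1)))
      (f' := fun w : ℂ => (t : ℂ) / (Complex.exp (t * w) - 1) -
        1 * (t / (Complex.exp (t * u) - 1)))
      (s := segment ℝ u v) (C := 1 / a ^ 2 * ‖v - u‖)
      (fun x hx => ((qg_deriv1 ht (ha.trans_le (hsub hx))).sub
        ((hasDerivAt_id x).mul_const _)).hasDerivWithinAt)
      (fun x hx => by rw [one_mul]; exact hlip x hx) (convex_segment u v)
      (left_mem_segment ℝ u v) (right_mem_segment ℝ u v)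
  calc _ = _ := by congr 1; ring
    _ ≤ _ := h2
    _ = _ := by ring

lemma qg_R_bound {t : ℝ} (ht : 0 < t) {z : ℂ} (hz : 1 ≤ z.re) (n : ℕ) :
    ‖qgR (qgL t) z n‖ ≤ (‖z - 1‖ ^ 2 + ‖z - 1‖) * (1 / ((n : ℝ) + 1) ^ 2) := by
  have ha : (0 : ℝ) < n + 1 := by positivity
  have h1 := qg_taylor ht ha (u := n + 1) (v := n + z) (by simp) (by simpa using hz)
  have h2 := qg_taylor ht ha (u := n + 1) (v := n + 2) (by simp) (by simp)
  have e1 : (n + z : ℂ) - (n + 1) = z - 1 := by ring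
  have e2 : (n + 2 : ℂ) - (n + 1) = 1 := by ring
  rw [e1] at h1
  rw [e2, norm_one] at h2
  set d := (t : ℂ) / (Complex.exp (t * (n + 1)) - 1)
  have e3 : qgR (qgL t) z n = (qgL t (n + z) - qgL t (n + 1) - (z - 1) * d)
      - (z - 1) * (qgL t (n + 2) - qgL t (n + 1) - 1 * d) := by
    unfold qgR; ring
  rw [e3]
  refine (norm_sub_le _ _).trans ?_
  rw [norm_mul]
  calc _ ≤ ‖z - 1‖ ^ 2 / ((n : ℝ) + 1) ^ 2 + ‖z - 1‖ * (1 ^ 2 / ((n : ℝ) + 1) ^ 2) := by gcongr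
    _ = _ := by ring

lemma qg_quot_tendsto (w : ℂ) :
    Tendsto (fun t : ℝ => (1 - Complex.exp (-(t * w))) / t) (nhdsWithin 0 (Set.Ioi 0))
      (nhds w) := by
  have h0 : HasDerivAt (fun t : ℝ => 1 - Complex.exp (-((t : ℂ) * w)))
      (-(Complex.exp (-(((0 : ℝ) : ℂ) * w)) * (-(1 * w)))) 0 :=
    (((Complex.ofRealCLM.hasDerivAt (x := (0 : ℝ))).mul_const w).neg.cexp).const_sub 1
  have h1 := h0.tendsto_slope.mono_left
    (nhdsWithin_mono 0 (fun x (hx : (0 : ℝ) < x) => (hx.ne' : x ≠ 0)))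
  simp only [Complex.ofReal_zero, zero_mul, neg_zero, Complex.exp_zero, one_mul, neg_neg] at h1
  refine h1.congr fun t => ?_
  simp [slope_def_module, div_eq_inv_mul]

lemma qg_R_tendsto {z : ℂ} (hz : 1 ≤ z.re) (n : ℕ) :
    Tendsto (fun t : ℝ => qgR (qgL t) z n) (nhdsWithin 0 (Set.Ioi 0))
      (nhds (qgR Complex.log z n)) := by
  have key : ∀ w : ℂ, 0 < w.re →
      Tendsto (fun t : ℝ => Complex.log ((1 - Complex.exp (-(t * w))) / t))
        (nhdsWithin 0 (Set.Ioi 0)) (nhds (Complex.log w)) := fun w hw =>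
    (qg_quot_tendsto w).clog (Or.inl hw)
  have hz1 : 0 < ((n : ℂ) + z).re := by simp; positivity
  have hz2 : 0 < ((n : ℂ) + 1).re := by simp; positivity
  have hz3 : 0 < ((n : ℂ) + 2).re := by simp; positivity
  have h := ((key _ hz1).sub (key _ hz2)).sub (((key _ hz3).sub (key _ hz2)).const_mul (z - 1))
  refine h.congr' ?_
  filter_upwards [self_mem_nhdsWithin] with t (ht : 0 < t)
  have e : ∀ w : ℂ, 0 < w.re → qgL t w =
      Real.log t + Complex.log ((1 - Complex.exp (-(t * w))) / t) := by
    intro w hw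
    have ht' : (t : ℂ) ≠ 0 := by exact_mod_cast ht.ne'
    rw [← Complex.log_ofReal_mul ht (div_ne_zero (Complex.slitPlane_ne_zero (qg_slit ht hw)) ht'),
      mul_div_cancel₀ _ ht', qgL]
  rw [qgR, e _ hz1, e _ hz2, e _ hz3]
  ring

lemma qg_partial (g : ℂ → ℂ) (z : ℂ) (N : ℕ) :
    Complex.exp (-∑ n ∈ Finset.range N, qgR g z n) =
      (∏ n ∈ Finset.range N, Complex.exp (g (n + 1))) /
      (∏ n ∈ Finset.range N, Complex.exp (g (n + z))) *
        Complex.exp ((z - 1) * (g (N + 1) - g 1)) := by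
  induction N with
  | zero => simp
  | succ N ih =>
    rw [Finset.sum_range_succ, neg_add, Complex.exp_add, ih, Finset.prod_range_succ,
      Finset.prod_range_succ, mul_div_mul_comm, ← Complex.exp_sub]
    have : Complex.exp ((z - 1) * (g (N + 1) - g 1)) * Complex.exp (-qgR g z N) =
      Complex.exp (g (N + 1) - g (N + z)) *
        Complex.exp ((z - 1) * (g ((N + 1 : ℕ) + 1) - g 1)) := by
      rw [← Complex.exp_add, ← Complex.exp_add]
      congr 1
      have : ((N + 1 : ℕ) : ℂ) + 1 = N + 2 := by push_cast; ring
      rw [this, qgR]; ring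
    rw [mul_assoc, this]; ring

lemma qg_summable_bd (z : ℂ) :
    Summable (fun n : ℕ => (‖z - 1‖ ^ 2 + ‖z - 1‖) * (1 / ((n : ℝ) + 1) ^ 2)) := by
  apply Summable.mul_left
  have := (summable_nat_add_iff 1).2 (Real.summable_one_div_nat_pow.2 (one_lt_two))
  simpa using this

lemma qg_gamma {z : ℂ} (hz : 1 ≤ z.re) :
    Complex.exp (-∑' n, qgR Complex.log z n) = Complex.Gamma z := by
  have hs : Summable (qgR Complex.log z) := by
    refine Summable.of_norm_bounded (qg_summable_bd z) fun n => ?_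
    refine le_of_tendsto (qg_R_tendsto hz n).norm ?_
    filter_upwards [self_mem_nhdsWithin] with t (ht : 0 < t)
    exact qg_R_bound ht hz n
  have h1 := (Complex.continuous_exp.tendsto _).comp hs.hasSum.tendsto_sum_nat.neg
  refine tendsto_nhds_unique h1 ?_
  have hinv : Tendsto (fun N : ℕ => 1 / ((N : ℂ) + 1)) atTop (nhds 0) :=
    tendsto_one_div_add_atTop_nhds_zero_nat
  have hrat : Tendsto (fun N : ℕ => (1 + (z - 1) * (1 / ((N : ℂ) + 1))) *
      (1 + z * (1 / ((N : ℂ) + 1)))) atTop (nhds 1) := by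
    simpa using ((hinv.const_mul (z - 1)).const_add 1).mul ((hinv.const_mul z).const_add 1)
  have h2 := ((Complex.GammaSeq_tendsto_Gamma z).comp (tendsto_add_atTop_nat 1)).mul hrat
  rw [mul_one] at h2
  refine h2.congr fun N => ?_
  have hne : ∀ j : ℕ, z + j ≠ 0 := fun j h => by
    have := congrArg Complex.re h
    simp at this
    have : (0 : ℝ) ≤ j := by positivity
    linarith
  have hN : (N : ℂ) + 1 ≠ 0 := by exact_mod_cast N.succ_ne_zero
  have hp : ∏ n ∈ Finset.range N, (z + (n : ℂ)) ≠ 0 := Finset.prod_ne_zero_iff.2 fun j _ => hne j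
  have e1 : ∏ n ∈ Finset.range N, Complex.exp (Complex.log ((n : ℂ) + 1)) = (N.factorial : ℂ) := by
    rw [← Finset.prod_range_add_one_eq_factorial, Nat.cast_prod]
    refine Finset.prod_congr rfl fun j _ => ?_
    rw [Complex.exp_log (by exact_mod_cast j.succ_ne_zero)]; push_cast; rfl
  have e2 : ∏ n ∈ Finset.range N, Complex.exp (Complex.log ((n : ℂ) + z)) =
      ∏ n ∈ Finset.range N, (z + (n : ℂ)) := by
    refine Finset.prod_congr rfl fun j _ => ?_
    rw [add_comm, Complex.exp_log (hne j)]
  have e3 : Complex.exp ((z - 1) * (Complex.log (N + 1) - Complex.log 1)) =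
      ((N : ℂ) + 1) ^ z / (N + 1) := by
    rw [Complex.log_one, sub_zero, mul_comm, ← Complex.cpow_def_of_ne_zero hN,
      Complex.cpow_sub _ _ hN, Complex.cpow_one]
  simp only [Function.comp_apply]
  rw [qg_partial, e1, e2, e3, Complex.GammaSeq, Finset.prod_range_succ, Finset.prod_range_succ,
    Nat.factorial_succ]
  have a1 := hne N
  have a2 := hne (N + 1)
  push_cast at a2 ⊢
  have : (1 + (z - 1) * (1 / ((N : ℂ) + 1))) * (1 + z * (1 / ((N : ℂ) + 1))) =
    (z + N) * (z + (N + 1)) / (N + 1) ^ 2 := by field_simp; ring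
  rw [this]
  field_simp

lemma qg_summable_geo {q : ℝ} (hq : q ∈ Set.Ioo 0 1) (a : ℂ) :
    Summable (fun k : ℕ => ‖-(a * (q : ℂ) ^ k)‖) := by
  have : Summable (fun k : ℕ => ‖a‖ * q ^ k) :=
    (summable_geometric_of_lt_one hq.1.le hq.2).mul_left _
  refine this.congr fun k => ?_
  rw [norm_neg, norm_mul, norm_pow, Complex.norm_real, Real.norm_of_nonneg hq.1.le]

lemma qg_mult {q : ℝ} (hq : q ∈ Set.Ioo 0 1) (a : ℂ) :
    Multipliable (fun k : ℕ => 1 - a * (q : ℂ) ^ k) := by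
  simpa [sub_eq_add_neg] using multipliable_one_add_of_summable (qg_summable_geo hq a)

lemma qg_eq {t : ℝ} (ht : 0 < t) {z : ℂ} (hz : 1 ≤ z.re) :
    Complex.exp (-∑' n, qgR (qgL t) z n) = qGamma (Real.exp (-t)) z := by
  have hq : Real.exp (-t) ∈ Set.Ioo (0 : ℝ) 1 := ⟨Real.exp_pos _, by simpa using ht⟩
  have hs : Summable (qgR (qgL t) z) :=
    Summable.of_norm_bounded (qg_summable_bd z) fun n => qg_R_bound ht hz n
  have h1 := (Complex.continuous_exp.tendsto _).comp hs.hasSum.tendsto_sum_nat.neg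
  refine tendsto_nhds_unique h1 ?_
  have hqz : ((Real.exp (-t) : ℝ) : ℂ) ^ z = Complex.exp (-(t * z)) := by
    rw [Complex.cpow_def_of_ne_zero (by exact_mod_cast (Real.exp_pos _).ne'),
      ← Complex.ofReal_log (Real.exp_pos _).le, Real.log_exp]
    congr 1; push_cast; ring
  have hterm : ∀ (w : ℂ) (k : ℕ), 0 < w.re → Complex.exp (qgL t (k + w)) =
      1 - Complex.exp (-(t * w)) * ((Real.exp (-t) : ℝ) : ℂ) ^ k := by
    intro w k hw
    rw [qgL, Complex.exp_log (Complex.slitPlane_ne_zero (qg_slit ht (by simp; positivity)))]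
    congr 1
    rw [Complex.ofReal_exp, ← Complex.exp_nat_mul, ← Complex.exp_add]
    congr 1; push_cast; ring
  have hP : ∀ w : ℂ, 0 < w.re →
      Tendsto (fun N : ℕ => ∏ n ∈ Finset.range N, Complex.exp (qgL t (n + w))) atTop
        (nhds (qPochInf (Complex.exp (-(t * w))) (Real.exp (-t) : ℝ))) := by
    intro w hw
    have := (qg_mult hq (Complex.exp (-(t * w)))).hasProd.tendsto_prod_nat
    refine this.congr fun N => Finset.prod_congr rfl fun k _ => (hterm w k hw).symm
  have hz0 : 0 < z.re := by linarith
  have hne : qPochInf (Complex.exp (-(t * z))) (Real.exp (-t) : ℝ) ≠ 0 := by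
    have := tprod_one_add_ne_zero_of_summable
      (f := fun k : ℕ => -(Complex.exp (-(t * z)) * ((Real.exp (-t) : ℝ) : ℂ) ^ k))
      (fun k => by
        rw [← sub_eq_add_neg, ← hterm z k hz0]; exact Complex.exp_ne_zero _)
      (qg_summable_geo hq _)
    simpa only [← sub_eq_add_neg, qPochInf] using this
  have hL : Tendsto (fun N : ℕ => qgL t (N + 1)) atTop (nhds 0) := by
    have h0 : Tendsto (fun N : ℕ => 1 - Complex.exp (-(t * 1)) * ((Real.exp (-t) : ℝ) : ℂ) ^ N)
        atTop (nhds 1) := by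
      have := tendsto_pow_atTop_nhds_zero_of_norm_lt_one (x := ((Real.exp (-t) : ℝ) : ℂ)) (by
        rw [Complex.norm_real, Real.norm_of_nonneg hq.1.le]; exact hq.2)
      simpa using (this.const_mul (Complex.exp (-(t * 1)))).const_sub 1
    have h2 := h0.clog Complex.one_mem_slitPlane
    rw [Complex.log_one] at h2
    refine h2.congr fun N => ?_
    rw [← hterm 1 N (by simp), qgL, Complex.exp_log
      (Complex.slitPlane_ne_zero (qg_slit ht (by simp; positivity)))]
  have hfin := ((hP 1 (by simp)).div (hP z hz0) hne).mul
    ((Complex.continuous_exp.tendsto _).comp ((hL.sub_const (qgL t 1)).const_mul (z - 1)))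
  have hG : qGamma (Real.exp (-t)) z =
      qPochInf (Complex.exp (-(t * 1))) (Real.exp (-t) : ℝ) /
      qPochInf (Complex.exp (-(t * z))) (Real.exp (-t) : ℝ) *
        Complex.exp ((z - 1) * (0 - qgL t 1)) := by
    have hq1 : ((Real.exp (-t) : ℝ) : ℂ) = Complex.exp (-(t * 1)) := by simp
    have h3 := Complex.slitPlane_ne_zero (qg_slit ht (w := 1) (by simp))
    rw [qGamma, hqz]
    congr 1
    · rw [← hq1]
    · rw [hq1, Complex.cpow_def_of_ne_zero h3, qgL]
      congr 1; ring
  rw [hG]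
  refine hfin.congr fun N => ?_
  simp only [Function.comp_apply]
  rw [qg_partial]
  rfl

lemma qg_base {z : ℂ} (hz : 1 ≤ z.re) :
    Tendsto (fun q : ℝ => qGamma q z) (nhdsWithin 1 (Set.Ioo 0 1))
      (nhds (Complex.Gamma z)) := by
  have h1 : Tendsto (fun t : ℝ => ∑' n, qgR (qgL t) z n) (nhdsWithin 0 (Set.Ioi 0))
      (nhds (∑' n, qgR Complex.log z n)) := by
    refine tendsto_tsum_of_dominated_convergence (qg_summable_bd z)
      (fun n => qg_R_tendsto hz n) ?_
    filter_upwards [self_mem_nhdsWithin] with t (ht : 0 < t) n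
    exact qg_R_bound ht hz n
  have h2 := (Complex.continuous_exp.tendsto _).comp h1.neg
  rw [qg_gamma hz] at h2
  have h3 : Tendsto (fun q : ℝ => -Real.log q) (nhdsWithin 1 (Set.Ioo 0 1))
      (nhdsWithin 0 (Set.Ioi 0)) := by
    refine tendsto_nhdsWithin_iff.2 ⟨?_, ?_⟩
    · have := (Real.continuousAt_log one_ne_zero).tendsto.neg
      rw [Real.log_one, neg_zero] at this
      exact this.mono_left nhdsWithin_le_nhds
    · filter_upwards [self_mem_nhdsWithin] with q hq
      exact neg_pos.2 (Real.log_neg hq.1 hq.2)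
  refine (h2.comp h3).congr' ?_
  filter_upwards [self_mem_nhdsWithin] with q hq
  have ht : 0 < -Real.log q := neg_pos.2 (Real.log_neg hq.1 hq.2)
  simp only [Function.comp_apply]
  rw [qg_eq ht hz, neg_neg, Real.exp_log hq.1]

lemma qg_func {q : ℝ} (hq : q ∈ Set.Ioo 0 1) (z : ℂ) :
    qGamma q z = qGamma q (z + 1) * ((1 - q) / (1 - (q : ℂ) ^ z)) := by
  have hq0 : (q : ℂ) ≠ 0 := by exact_mod_cast hq.1.ne'
  have hq1 : (1 : ℂ) - q ≠ 0 := by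
    rw [sub_ne_zero]; exact_mod_cast hq.2.ne'
  have h1 : qPochInf ((q : ℂ) ^ z) q = (1 - (q : ℂ) ^ z) * qPochInf ((q : ℂ) ^ (z + 1)) q := by
    have e : ∀ k : ℕ, 1 - (q : ℂ) ^ z * (q : ℂ) ^ (k + 1) =
        1 - (q : ℂ) ^ (z + 1) * (q : ℂ) ^ k := fun k => by
      rw [Complex.cpow_add _ _ hq0, Complex.cpow_one]; ring
    unfold qPochInf
    rw [tprod_eq_zero_mul' (by simp only [e]; exact qg_mult hq _)]
    simp only [e, pow_zero, mul_one]
  have h2 : ((1 : ℂ) - q) ^ (1 - z) = (1 - q) ^ (1 - (z + 1)) * (1 - q) := by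
    rw [show 1 - z = (1 - (z + 1)) + 1 by ring, Complex.cpow_add _ _ hq1, Complex.cpow_one]
  rw [qGamma, qGamma, h1, h2, div_eq_mul_inv, div_eq_mul_inv, div_eq_mul_inv, mul_inv]
  ring

lemma qg_factor {z : ℂ} (hz : z ≠ 0) :
    Tendsto (fun q : ℝ => ((1 : ℂ) - q) / (1 - (q : ℂ) ^ z)) (nhdsWithin 1 (Set.Ioo 0 1))
      (nhds (1 / z)) := by
  have h0 : HasDerivAt (fun x : ℂ => x ^ z) (z * 1 ^ (z - 1) * 1) ((1 : ℝ) : ℂ) := by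
    simpa using (hasDerivAt_id (1 : ℂ)).cpow_const (c := z) Complex.one_mem_slitPlane
  have h1 := h0.comp_ofReal.tendsto_slope.mono_left
    (nhdsWithin_mono 1 (fun x (hx : x ∈ Set.Ioo (0 : ℝ) 1) => (hx.2.ne : x ≠ 1)))
  rw [Complex.one_cpow, mul_one, mul_one] at h1
  have h2 := h1.inv₀ hz
  rw [one_div]
  refine h2.congr fun q => ?_
  rw [slope_def_module, Complex.real_smul, mul_inv]
  push_cast
  rw [inv_inv, Complex.one_cpow, div_eq_mul_inv, ← neg_sub (1 : ℂ) ((q : ℂ) ^ z), inv_neg]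
  ring

lemma qg_all (m : ℕ) : ∀ z : ℂ, (∀ n : ℕ, z ≠ -n) → 1 ≤ z.re + m →
    Tendsto (fun q : ℝ => qGamma q z) (nhdsWithin 1 (Set.Ioo 0 1))
      (nhds (Complex.Gamma z)) := by
  induction m with
  | zero => intro z _ h; exact qg_base (by simpa using h)
  | succ m ih =>
    intro z hz h
    have hz0 : z ≠ 0 := by simpa using hz 0
    have h1 := ih (z + 1) (fun n hn => hz (n + 1) (by
      push_cast; rw [neg_add, ← hn]; ring)) (by push_cast at h; simp; linarith)
    have h2 := h1.mul (qg_factor hz0)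
    rw [Complex.Gamma_add_one z hz0, show z * Complex.Gamma z * (1 / z) = Complex.Gamma z by
      field_simp] at h2
    refine h2.congr' ?_
    filter_upwards [self_mem_nhdsWithin] with q hq
    exact (qg_func hq z).symm

theorem qGamma_tendsto_Gamma (z : ℂ) (hz : ∀ n : ℕ, z ≠ -n) :
    Tendsto (fun q : ℝ => qGamma q z) (nhdsWithin 1 (Set.Ioo 0 1))
      (nhds (Complex.Gamma z)) := by
  obtain ⟨m, hm⟩ := exists_nat_ge (1 - z.re)
  exact qg_all m z hz (by linarith)
end
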